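/- Let m ≥ 1 be an integer, and let u_n be defined by the formal power series identity (∑_{n=0}^{2m-1} (-1)^n x^n/n!)^{-1} = ∑_{n=0}^∞ u_n x^n/n! over ℚ. Then for every n ≥ 0, u_n equals the number of permutations of [n] = {1,2,…,n} in which every increasing run has length congruent to 0 or 1 modulo 2m. -/

import Mathlib

/-- The lengths of the maximal increasing runs of a list. -/
def runLengths {α : Type*} [LinearOrder α] : List α → List ℕ
  | [] => []
  | [_] => [1]
  | a :: b :: l =>
    match runLengths (b :: l) with
    | [] => [1]
    | k :: ks => if a < b then (k + 1) :: ks else 1 :: k :: ks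

/-- A nonempty list has a first increasing run of length `r`: the strictly increasing prefixes are
those of length at most `r`, and dropping a prefix of the run shortens it or removes it. -/
theorem exists_runLengths_eq_cons {α : Type*} [LinearOrder α] :
    ∀ l : List α, l ≠ [] → ∃ r ks, 1 ≤ r ∧ r ≤ l.length ∧
      (∀ k ≤ l.length, (l.take k).IsChain (· < ·) ↔ k ≤ r) ∧
      (∀ k < r, runLengths (l.drop k) = (r - k) :: ks) ∧ runLengths (l.drop r) = ks
  | [], h => absurd rfl h
  | [a], _ => by
    refine ⟨1, [], le_rfl, by simp, fun k hk => ?_, fun k hk => ?_, by simp [runLengths]⟩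
    · have hk' : k ≤ 1 := by simpa using hk
      interval_cases k <;> simp
    · obtain rfl : k = 0 := by omega
      simp [runLengths]
  | a :: b :: l, _ => by
    obtain ⟨r, ks, hr, hrl, htake, hdrop, hlast⟩ := exists_runLengths_eq_cons (b :: l) (by simp)
    have h0 : runLengths (b :: l) = r :: ks := by simpa using hdrop 0 (by omega)
    by_cases hab : a < b
    · refine ⟨r + 1, ks, by omega, by simpa using hrl, fun k hk => ?_, fun k hk => ?_,
        by simpa using hlast⟩
      · rcases k with _ | _ | k
        · simp
        · simp
        · have := htake (k + 1) (by simpa using hk)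
          simp only [List.take_succ_cons, List.isChain_cons_cons, hab, true_and] at this ⊢
          rw [this]
          omega
      · rcases k with _ | k
        · simp [runLengths, h0, hab]
        · simpa using hdrop k (by omega)
    · refine ⟨1, r :: ks, le_rfl, by simp, fun k hk => ?_, fun k hk => ?_, by simpa using h0⟩
      · rcases k with _ | _ | k
        · simp
        · simp
        · simp [hab]
      · obtain rfl : k = 0 := by omega
        simp [runLengths, h0, hab]

/-- The formal identity `(∑ n < 2m, (-x)^n) * ∑ {x^n | n ≡ 0, 1 mod 2m} = 1`, in positive
degrees. -/
theorem sum_truncated_neg_one_pow_mul_indicator (m r : ℕ) (hm : 1 ≤ m) (hr : 1 ≤ r) :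
    ∑ k ∈ Finset.range (r + 1), (if k < 2 * m then (-1 : ℚ) ^ k else 0) *
      (if (r - k) % (2 * m) = 0 ∨ (r - k) % (2 * m) = 1 then 1 else 0) = 0 := by
  obtain ⟨q, s, hs, rfl⟩ : ∃ q s, s < 2 * m ∧ r = s + 2 * m * q :=
    ⟨r / (2 * m), r % (2 * m), Nat.mod_lt _ (by omega), (Nat.mod_add_div _ _).symm⟩
  have hmod_le : ∀ k ≤ s, (s + 2 * m * q - k) % (2 * m) = s - k := fun k hk => by
    rw [show s + 2 * m * q - k = (s - k) + 2 * m * q by omega, Nat.add_mul_mod_self_left,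
      Nat.mod_eq_of_lt (by omega)]
  have hmod_gt : ∀ k, s < k → k < 2 * m → k ≤ s + 2 * m * q →
      (s + 2 * m * q - k) % (2 * m) = 2 * m + s - k := fun k hk hkm hkr => by
    rcases q with _ | q
    · omega
    · rw [mul_add, show s + (2 * m * q + 2 * m * 1) - k = (2 * m + s - k) + 2 * m * q by omega,
        Nat.add_mul_mod_self_left, Nat.mod_eq_of_lt (by omega)]
  have hne : s ≠ if s = 0 then 2 * m - 1 else s - 1 := by split_ifs <;> omega
  have hbound : s = 0 → 2 * m ≤ 2 * m * q := fun h => by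
    rcases q with _ | q
    · omega
    · exact Nat.le_mul_of_pos_right _ (by omega)
  rw [← Finset.sum_subset (s₁ := {s, if s = 0 then 2 * m - 1 else s - 1})]
  · rw [Finset.sum_pair hne]
    rcases Nat.eq_zero_or_pos s with h | h
    · subst h
      have h1 := hmod_le 0 le_rfl
      have h2 := hmod_gt (2 * m - 1) (by omega) (by omega) (by have := hbound rfl; omega)
      have hodd : Odd (2 * m - 1) := ⟨m - 1, by omega⟩
      rw [if_pos rfl, if_pos (by omega), if_pos (by omega), if_pos (by omega),
        if_pos (by omega), hodd.neg_one_pow]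
      norm_num
    · have h1 := hmod_le s le_rfl
      have h2 := hmod_le (s - 1) (by omega)
      obtain ⟨t, rfl⟩ : ∃ t, s = t + 1 := ⟨s - 1, by omega⟩
      rw [if_neg (by omega : ¬ t + 1 = 0), if_pos (by omega), if_pos (by omega),
        if_pos (by omega), if_pos (by omega), Nat.add_sub_cancel, pow_succ]
      ring
  · intro k hk
    simp only [Finset.mem_insert, Finset.mem_singleton] at hk
    rw [Finset.mem_range]
    split_ifs at hk with h
    · have := hbound h
      omega
    · omega
  · intro k hk hk'
    simp only [Finset.mem_insert, Finset.mem_singleton, not_or, Finset.mem_range] at hk hk'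
    by_cases hkm : k < 2 * m
    · rw [if_neg (c := _ ∨ _), mul_zero]
      rcases le_or_gt k s with hks | hks
      · rw [hmod_le k hks]
        split_ifs at hk' <;> omega
      · rw [hmod_gt k hks hkm (by omega)]
        split_ifs at hk' <;> omega
    · rw [if_neg hkm, zero_mul]

/-- The alternating sum over the increasing prefixes of length less than `2m` of a nonempty list,
restricted to those whose remaining list has all run lengths `≡ 0, 1 mod 2m`, vanishes. -/
theorem sum_isChain_take_eq_zero {α : Type*} [LinearOrder α] (m : ℕ) (hm : 1 ≤ m)
    (l : List α) (hl : l ≠ []) :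
    ∑ k ∈ Finset.range (l.length + 1) with (l.take k).IsChain (· < ·),
      (if k < 2 * m then (-1 : ℚ) ^ k else 0) *
      (if ∀ j ∈ runLengths (l.drop k), j % (2 * m) = 0 ∨ j % (2 * m) = 1 then 1 else 0) = 0 := by
  obtain ⟨r, ks, hr, hrl, htake, hdrop, hlast⟩ := exists_runLengths_eq_cons l hl
  have hfilter : {k ∈ Finset.range (l.length + 1) | (l.take k).IsChain (· < ·)}
      = Finset.range (r + 1) := by
    ext k
    simp only [Finset.mem_filter, Finset.mem_range]
    constructor
    · rintro ⟨h1, h2⟩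
      have := (htake k (by omega)).1 h2
      omega
    · intro h
      exact ⟨by omega, (htake k (by omega)).2 (by omega)⟩
  rw [hfilter]
  calc _ = ∑ k ∈ Finset.range (r + 1), (if k < 2 * m then (-1 : ℚ) ^ k else 0) *
      (if (r - k) % (2 * m) = 0 ∨ (r - k) % (2 * m) = 1 then 1 else 0) *
      (if ∀ j ∈ ks, j % (2 * m) = 0 ∨ j % (2 * m) = 1 then 1 else 0) := by
        refine Finset.sum_congr rfl fun k hk => ?_
        rw [Finset.mem_range] at hk
        rcases (show k ≤ r by omega).lt_or_eq with h | rfl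
        · rw [hdrop k h, mul_assoc]
          congr 1
          rw [ite_zero_mul_ite_zero, one_mul]
          simp only [List.forall_mem_cons]
        · rw [hlast]
          simp
    _ = 0 := by
        rw [← Finset.sum_mul, sum_truncated_neg_one_pow_mul_indicator m r hm hr, zero_mul]

/-- The lists enumerating the elements of `S` without repetition. -/
def arrangements {α : Type*} [DecidableEq α] (S : Finset α) : Finset (List α) :=
  S.val.lists.toFinset

theorem mem_arrangements {α : Type*} [DecidableEq α] {S : Finset α} {l : List α} :
    l ∈ arrangements S ↔ S.val = l := by
  simp [arrangements, Multiset.mem_lists_iff]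

/-- Splitting an arrangement of `S` after an increasing prefix amounts to choosing a subset `T` of
`S` and an arrangement of `S \ T`. -/
theorem sum_powerset_sum_arrangements {α M : Type*} [LinearOrder α] [AddCommMonoid M] (S : Finset α)
    (f : ℕ → List α → M) :
    ∑ T ∈ S.powerset, ∑ l ∈ arrangements (S \ T), f T.card l =
      ∑ l ∈ arrangements S, ∑ k ∈ Finset.range (l.length + 1) with (l.take k).IsChain (· < ·),
        f k (l.drop k) := by
  rw [Finset.sum_sigma', Finset.sum_sigma']
  have hsplit : ∀ T ⊆ S, ∀ l : List α, (S \ T).val = l → S.val = ↑(T.sort ++ l) := by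
    intro T hT l hl
    rw [← Multiset.coe_add, Finset.sort_eq, ← hl, Finset.sdiff_val,
      add_tsub_cancel_of_le (Finset.val_le_iff.2 hT)]
  have htake_val : ∀ (l : List α) (k : ℕ), S.val = l → (l.take k).toFinset.val = l.take k := by
    intro l k hl
    have hnodup : l.Nodup := by
      rw [← Multiset.coe_nodup, ← hl]
      exact S.nodup
    rw [List.toFinset_val, (hnodup.sublist (List.take_sublist k l)).dedup]
  refine Finset.sum_bij' (fun x _ => ⟨x.1.sort ++ x.2, x.1.card⟩)
    (fun y _ => ⟨(y.1.take y.2).toFinset, y.1.drop y.2⟩) ?_ ?_ ?_ ?_ ?_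
  · rintro ⟨T, l⟩ h
    simp only [Finset.mem_sigma, Finset.mem_powerset, mem_arrangements, Finset.mem_filter,
      Finset.mem_range] at h ⊢
    refine ⟨hsplit T h.1 l h.2, by simp, ?_⟩
    rw [List.take_left' (by simp)]
    exact (Finset.sortedLT_sort T).isChain
  · rintro ⟨l, k⟩ h
    simp only [Finset.mem_sigma, Finset.mem_powerset, mem_arrangements, Finset.mem_filter,
      Finset.mem_range] at h ⊢
    obtain ⟨h1, h2, h3⟩ := h
    have hval := htake_val l k h1
    have hsub : (l.take k).toFinset ⊆ S := by
      rw [← Finset.val_le_iff, hval, h1, Multiset.coe_le]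
      exact (List.take_sublist k l).subperm
    refine ⟨hsub, ?_⟩
    rw [Finset.sdiff_val, hval, h1, tsub_eq_iff_eq_add_of_le, add_comm, Multiset.coe_add,
      List.take_append_drop]
    rw [Multiset.coe_le]
    exact (List.take_sublist k l).subperm
  · rintro ⟨T, l⟩ h
    simp
  · rintro ⟨l, k⟩ h
    simp only [Finset.mem_sigma, mem_arrangements, Finset.mem_filter,
      Finset.mem_range] at h ⊢
    obtain ⟨h1, h2, h3⟩ := h
    have hval := htake_val l k h1
    have hsort : (l.take k).toFinset.sort = l.take k := by
      refine ((List.toFinset_sort (· ≤ ·) ?_).2 h3.sortedLT.sortedLE.pairwise)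
      exact h3.sortedLT.nodup
    have hcard : (l.take k).toFinset.card = k := by
      rw [← Finset.card_val, hval, Multiset.coe_card, List.length_take]
      omega
    simp [hsort, hcard]
  · rintro ⟨T, l⟩ h
    simp

/-- The recurrence encoded by the reciprocal of the truncated exponential series. -/
theorem sum_choose_mul_of_inv_eq (m : ℕ) (hm : 1 ≤ m) (u : ℕ → ℚ)
    (hu : (PowerSeries.mk fun n => if n < 2 * m then (-1 : ℚ) ^ n / n.factorial else 0)⁻¹
      = PowerSeries.mk fun n => u n / n.factorial) (n : ℕ) :
    ∑ k ∈ Finset.range (n + 1), n.choose k • ((if k < 2 * m then (-1 : ℚ) ^ k else 0) * u (n - k))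
      = if n = 0 then 1 else 0 := by
  have hmul := PowerSeries.mul_inv_cancel
    (PowerSeries.mk fun n => if n < 2 * m then (-1 : ℚ) ^ n / n.factorial else 0)
    (by simp; omega)
  rw [hu] at hmul
  have hcoeff := congrArg (fun p => (n.factorial : ℚ) * PowerSeries.coeff n p) hmul
  simp only [PowerSeries.coeff_mul, PowerSeries.coeff_mk, PowerSeries.coeff_one,
    Finset.mul_sum] at hcoeff
  rw [Finset.Nat.sum_antidiagonal_eq_sum_range_succ_mk] at hcoeff
  calc _ = _ := Finset.sum_congr rfl fun k hk => ?_
    _ = _ := hcoeff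
    _ = _ := by split_ifs with h <;> simp [h]
  rw [Finset.mem_range] at hk
  rw [nsmul_eq_mul, Nat.cast_choose ℚ (by omega)]
  have h1 : (k.factorial : ℚ) ≠ 0 := by positivity
  have h2 : ((n - k).factorial : ℚ) ≠ 0 := by positivity
  split_ifs
  · field_simp
  · simp

/-- The number of arrangements of `S` with all run lengths `≡ 0, 1 mod 2m` is determined by the
recurrence for the reciprocal of the truncated exponential series. -/
theorem sum_arrangements_indicator_eq {α : Type*} [LinearOrder α] (m : ℕ) (hm : 1 ≤ m) (u : ℕ → ℚ)
    (hu : ∀ n, ∑ k ∈ Finset.range (n + 1),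
      n.choose k • ((if k < 2 * m then (-1 : ℚ) ^ k else 0) * u (n - k)) = if n = 0 then 1 else 0)
    (S : Finset α) :
    ∑ l ∈ arrangements S, (if ∀ j ∈ runLengths l, j % (2 * m) = 0 ∨ j % (2 * m) = 1 then (1 : ℚ)
      else 0) = u S.card := by
  induction S using Finset.strongInduction with
  | H S ih =>
  have hrec := hu S.card
  rw [← Finset.sum_powerset_apply_card
    (fun k => (if k < 2 * m then (-1 : ℚ) ^ k else 0) * u (S.card - k))] at hrec
  rcases S.eq_empty_or_nonempty with rfl | hS
  · have h0 : arrangements (∅ : Finset α) = {[]} := by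
      ext l
      simp [mem_arrangements, eq_comm]
    have hm' : 0 < m := hm
    rw [h0, Finset.sum_singleton]
    simpa [runLengths, hm'] using hrec.symm
  have hsum := sum_powerset_sum_arrangements S fun k l => (if k < 2 * m then (-1 : ℚ) ^ k else 0) *
    (if ∀ j ∈ runLengths l, j % (2 * m) = 0 ∨ j % (2 * m) = 1 then 1 else 0)
  rw [Finset.sum_eq_zero (s := arrangements S)] at hsum
  swap
  · intro l hl
    refine sum_isChain_take_eq_zero m hm l ?_
    rintro rfl
    rw [mem_arrangements] at hl
    exact hS.ne_empty (Finset.val_eq_zero.1 hl)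
  replace hrec := (hrec.trans (if_neg hS.card_ne_zero)).trans hsum.symm
  rw [← Finset.add_sum_erase _ _ (Finset.empty_mem_powerset S),
    ← Finset.add_sum_erase _ (fun T => ∑ l ∈ arrangements (S \ T), _)
      (Finset.empty_mem_powerset S)] at hrec
  rw [Finset.sum_congr (g := fun T => ∑ l ∈ arrangements (S \ T),
    (if T.card < 2 * m then (-1 : ℚ) ^ T.card else 0) *
    (if ∀ j ∈ runLengths l, j % (2 * m) = 0 ∨ j % (2 * m) = 1 then 1 else 0)) rfl] at hrec
  · have h0 : 0 < 2 * m := by omega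
    simpa [h0] using (add_right_cancel hrec).symm
  · intro T hT
    rw [Finset.mem_erase, Finset.mem_powerset] at hT
    rw [← Finset.mul_sum, ih _ (Finset.sdiff_ssubset hT.2 (Finset.nonempty_iff_ne_empty.2 hT.1)),
      Finset.card_sdiff_of_subset hT.2]

/-- The reciprocal of the partial sum $\sum_{n=0}^{2m-1}(-1)^n x^n/n!$ is the exponential
generating function for permutations in which every increasing run has length congruent to
0 or 1 modulo $2m$. -/
theorem stmt_0 (m : ℕ) (hm : 1 ≤ m) (u : ℕ → ℚ)
    (hu : (PowerSeries.mk fun n => if n < 2 * m then (-1 : ℚ) ^ n / n.factorial else 0)⁻¹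
      = PowerSeries.mk fun n => u n / n.factorial) :
    ∀ n : ℕ, u n = Nat.card {σ : Equiv.Perm (Fin n) //
      ∀ k ∈ runLengths (List.ofFn ⇑σ), k % (2 * m) = 0 ∨ k % (2 * m) = 1} := by
  intro n
  have h := sum_arrangements_indicator_eq m hm u (sum_choose_mul_of_inv_eq m hm u hu)
    (Finset.univ : Finset (Fin n))
  rw [Finset.card_univ, Fintype.card_fin] at h
  rw [← h, Nat.card_eq_fintype_card, Fintype.card_subtype, Finset.card_filter, Nat.cast_sum]
  symm
  refine Finset.sum_bij (fun σ _ => List.ofFn σ) ?_ ?_ ?_ ?_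
  · intro σ _
    rw [mem_arrangements, ← Fin.univ_val_map, Multiset.map_univ_val_equiv]
  · intro σ _ τ _ h
    exact DFunLike.coe_injective (List.ofFn_injective h)
  · intro l hl
    rw [mem_arrangements] at hl
    have hlen : l.length = n := by
      rw [← Multiset.coe_card, ← hl, Finset.card_val, Finset.card_univ, Fintype.card_fin]
    have hnodup : l.Nodup := by
      rw [← Multiset.coe_nodup, ← hl]
      exact Finset.univ.nodup
    refine ⟨Equiv.ofBijective (l.get ∘ Fin.cast hlen.symm) (Finite.injective_iff_bijective.1
      (hnodup.injective_get.comp (Fin.cast_injective _))), Finset.mem_univ _, ?_⟩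
    exact List.ext_getElem (by simp [hlen]) (by simp)
  · intro σ _
    push_cast
    rfl
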